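/- (Alberti's rank-one theorem.) Let Ω ⊂ ℝ^d be an open set and let u ∈ BV(Ω; ℝ^ℓ). Then for |D^s u|-almost every x ∈ Ω there exist a(x) ∈ ℝ^ℓ ∖ {0} and b(x) ∈ ℝ^d ∖ {0} such that the polar of Du satisfies d(D^s u)/d|D^s u|(x) = a(x) ⊗ b(x), i.e. the matrix d(D^s u)/d|D^s u|(x) has rank one. -/

import Mathlib

open MeasureTheory Metric

/-- The partial derivative `∂_j φ` of a scalar function on `ℝ^d`. -/
noncomputable def pderiv' {d : ℕ} (j : Fin d) (φ : EuclideanSpace ℝ (Fin d) → ℝ) :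
    EuclideanSpace ℝ (Fin d) → ℝ :=
  fun x => fderiv ℝ φ x (EuclideanSpace.single j 1)

/-- A finite set without chains of more than `m` elements carries a strictly monotone rank with
values in `{1, …, m}`. -/
lemma exists_rank_of_card_chain_le {α : Type*} (r : α → α → Prop) [IsStrictOrder α r]
    (P : Finset α) (m : ℕ)
    (h : ∀ c ⊆ P, IsChain r (c : Set α) → c.card ≤ m) :
    ∃ w : α → ℕ, (∀ p ∈ P, 1 ≤ w p ∧ w p ≤ m) ∧ ∀ p ∈ P, ∀ q ∈ P, r q p → w q < w p := by
  classical
  set C : α → Finset (Finset α) := fun p => P.powerset.filter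
    (fun c => IsChain r (c : Set α) ∧ p ∈ c ∧ ∀ q ∈ c, q = p ∨ r q p) with hC
  have hmem : ∀ p c, c ∈ C p ↔ c ⊆ P ∧ IsChain r (c : Set α) ∧ p ∈ c ∧ ∀ q ∈ c, q = p ∨ r q p := by
    intro p c; simp [hC]
  refine ⟨fun p => (C p).sup Finset.card, fun p hp => ⟨?_, ?_⟩, fun p hp q hq hqp => ?_⟩
  · have : ({p} : Finset α) ∈ C p := by
      rw [hmem]; simp [hp]
    simpa using Finset.le_sup (f := Finset.card) this
  · refine Finset.sup_le fun c hc => ?_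
    rw [hmem] at hc
    exact h c hc.1 hc.2.1
  · have hne : (C q).Nonempty := ⟨{q}, by rw [hmem]; simp [hq]⟩
    obtain ⟨c, hc, hcs⟩ := Finset.exists_mem_eq_sup (C q) hne Finset.card
    have hc' := (hmem _ _).1 hc
    have hpc : p ∉ c := by
      intro hpc
      rcases hc'.2.2.2 p hpc with h1 | h1
      · subst h1; exact irrefl_of r p hqp
      · exact irrefl_of r p (trans_of r h1 hqp)
    have hlt : ∀ x ∈ c, r x p := by
      intro x hx
      rcases hc'.2.2.2 x hx with h1 | h1
      · rw [h1]; exact hqp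
      · exact trans_of r h1 hqp
    have hin : insert p c ∈ C p := by
      rw [hmem]
      refine ⟨Finset.insert_subset hp hc'.1, ?_, Finset.mem_insert_self _ _, ?_⟩
      · rw [Finset.coe_insert]
        exact hc'.2.1.insert fun b hb _ => Or.inr (hlt b hb)
      · intro x hx
        rcases Finset.mem_insert.1 hx with h1 | h1
        · exact Or.inl h1
        · exact Or.inr (hlt x h1)
    have := Finset.le_sup (f := Finset.card) hin
    rw [Finset.card_insert_of_notMem hpc] at this
    change (C q).sup Finset.card < _
    rw [hcs]; exact this

/-- Greedy removal of chains with more than `m` elements. -/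
lemma exists_chain_decomposition {α : Type*} [DecidableEq α] (r : α → α → Prop) (m : ℕ) (n : ℕ) :
    ∀ P : Finset α, P.card ≤ n → ∃ A B : Finset α, A ∪ B = P ∧
      (∀ c ⊆ A, IsChain r (c : Set α) → c.card ≤ m) ∧
      ∃ (f : α → ℕ) (j : ℕ), j * (m + 1) ≤ P.card ∧ (∀ p ∈ B, f p < j) ∧
        ∀ p ∈ B, ∀ q ∈ B, f p = f q → p ≠ q → r p q ∨ r q p := by
  induction n with
  | zero =>
    intro P hP
    have : P = ∅ := by simpa using hP
    subst this
    refine ⟨∅, ∅, by simp, fun c hc _ => ?_, fun _ => 0, 0, by simp, by simp, by simp⟩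
    simp [Finset.subset_empty.1 hc]
  | succ n ih =>
    intro P hP
    by_cases h : ∀ c ⊆ P, IsChain r (c : Set α) → c.card ≤ m
    · exact ⟨P, ∅, by simp, h, fun _ => 0, 0, by simp, by simp, by simp⟩
    push Not at h
    obtain ⟨c, hcP, hc, hm⟩ := h
    have hcard : (P \ c).card + c.card = P.card := Finset.card_sdiff_add_card_eq_card hcP
    obtain ⟨A, B, hAB, hA, f, j, hj, hf, hB⟩ := ih (P \ c) (by omega)
    have hBc : ∀ p ∈ B, p ∉ c := by
      intro p hp
      have : p ∈ P \ c := hAB ▸ Finset.mem_union_right _ hp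
      exact (Finset.mem_sdiff.1 this).2
    refine ⟨A, B ∪ c, ?_, hA, fun p => if p ∈ c then j else f p, j + 1, ?_, ?_, ?_⟩
    · rw [← Finset.union_assoc, hAB, Finset.sdiff_union_of_subset hcP]
    · rw [add_mul]; omega
    · intro p hp
      by_cases hpc : p ∈ c
      · simp [hpc]
      · have : p ∈ B := by simpa [hpc] using hp
        simp only [hpc, if_false]
        have := hf p this
        omega
    · intro p hp q hq hpq hne
      by_cases hpc : p ∈ c <;> by_cases hqc : q ∈ c
      · exact hc hpc hqc hne
      · have hq' : q ∈ B := by simpa [hqc] using hq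
        simp only [hpc, hqc, if_true, if_false] at hpq
        have := hf q hq'
        omega
      · have hp' : p ∈ B := by simpa [hpc] using hp
        simp only [hpc, hqc, if_true, if_false] at hpq
        have := hf p hp'
        omega
      · have hq' : q ∈ B := by simpa [hqc] using hq
        have hp' : p ∈ B := by simpa [hpc] using hp
        simp only [hpc, hqc, if_false] at hpq
        exact hB p hp' q hq' hpq hne

/-- If no two points are comparable for both strict orders `r` and `s`, a set of at most `m ^ 2`
points splits into two parts having ranks at most `m` for `r` and `s`, respectively. -/
lemma exists_two_ranks {α : Type*} [DecidableEq α] (r s : α → α → Prop) [IsStrictOrder α r]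
    [IsStrictOrder α s] (hrs : ∀ p q, r p q → ¬ s p q ∧ ¬ s q p)
    (P : Finset α) (m : ℕ) (hP : P.card ≤ m ^ 2) :
    ∃ (A B : Finset α) (v w : α → ℕ), A ∪ B = P ∧
      (∀ p ∈ A, 1 ≤ v p ∧ v p ≤ m) ∧ (∀ p ∈ A, ∀ q ∈ A, r q p → v q < v p) ∧
      (∀ p ∈ B, 1 ≤ w p ∧ w p ≤ m) ∧ (∀ p ∈ B, ∀ q ∈ B, s q p → w q < w p) := by
  obtain ⟨A, B, hAB, hA, f, j, hj, hf, hB⟩ := exists_chain_decomposition r m _ P le_rfl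
  obtain ⟨v, hv, hv'⟩ := exists_rank_of_card_chain_le r A m hA
  have hjm : j ≤ m := by
    by_contra! hlt
    nlinarith
  obtain ⟨w, hw, hwv⟩ := exists_rank_of_card_chain_le s B m (by
    intro c hc hch
    refine le_trans ?_ hjm
    rw [← Finset.card_range j]
    refine Finset.card_le_card_of_injOn f (fun p hp => by simpa using hf p (hc hp)) ?_
    intro p hp q hq hpq
    by_contra hne
    rcases hB p (hc hp) q (hc hq) hpq hne with h | h <;>
    rcases hch hp hq hne with h' | h'
    · exact (hrs _ _ h).1 h'
    · exact (hrs _ _ h).2 h'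
    · exact (hrs _ _ h).2 h'
    · exact (hrs _ _ h).1 h')
  exact ⟨A, B, v, w, hAB, hv, hv', hw, hwv⟩

/-- The staircase function of a ranked finite set of squares. -/
lemma exists_staircase (P : Finset (ℝ × ℝ)) (m : ℕ) (w : ℝ × ℝ → ℕ) (a : ℝ) (ha : 0 < a)
    (hw : ∀ p ∈ P, 1 ≤ w p ∧ w p ≤ m)
    (hlt : ∀ p ∈ P, ∀ q ∈ P, q.1 < p.1 ∧ q.2 < p.2 → w q < w p) :
    ∃ X : ℝ × ℝ → ℝ, (∀ x, 0 ≤ X x ∧ X x ≤ 2 * a * m) ∧ (∀ x y, x ≤ y → X x ≤ X y) ∧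
      (∀ x t, 0 ≤ t → X (x + (t, t)) ≤ X x + t) ∧
      (∀ p ∈ P, ∀ x t, 0 ≤ t → p.1 - a ≤ x.1 → p.2 - a ≤ x.2 → x.1 + t ≤ p.1 + a →
        x.2 + t ≤ p.2 + a → X x + t ≤ X (x + (t, t))) := by
  set g : ℝ × ℝ → ℝ × ℝ → ℝ := fun p x =>
    max 0 (min (2 * a * w p) (2 * a * (w p - 1) + (min (x.1 - p.1) (x.2 - p.2) + a))) with hg
  have hbdd : ∀ x, BddAbove (Set.range fun p : P => g p x) := fun x => (Set.finite_range _).bddAbove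
  have hle : ∀ x, ∀ p ∈ P, g p x ≤ ⨆ p : P, g p x := fun x p hp =>
    le_ciSup (f := fun p : P => g p x) (hbdd x) ⟨p, hp⟩
  have h0 : ∀ x, 0 ≤ ⨆ p : P, g p x := fun x => Real.iSup_nonneg fun p => le_max_left _ _
  refine ⟨fun x => ⨆ p : P, g p x, fun x => ⟨h0 x, ?_⟩, fun x y hxy => ?_, fun x t ht => ?_, ?_⟩
  · refine Real.iSup_le (fun p => ?_) (by positivity)
    refine max_le (by positivity) ((min_le_left _ _).trans ?_)
    have : (w p : ℝ) ≤ m := by exact_mod_cast (hw p p.2).2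
    gcongr
  · refine Real.iSup_le (fun p => le_trans ?_ (hle y p p.2)) (h0 y)
    have h1 := hxy.1
    have h2 := hxy.2
    simp only [hg]
    gcongr
  · refine Real.iSup_le (fun p => ?_) (by linarith [h0 x])
    refine le_trans ?_ (add_le_add_left (hle x p p.2) t)
    simp only [hg, Prod.fst_add, Prod.snd_add]
    grind
  · intro p hp x t ht h1 h2 h3 h4
    have hwp : (1 : ℝ) ≤ w p := by exact_mod_cast (hw p hp).1
    have key : 2 * a * (w p - 1) + t ≤ g p (x + (t, t)) := by
      simp only [hg, Prod.fst_add, Prod.snd_add]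
      refine le_max_of_le_right (le_min ?_ ?_)
      · linarith
      · have : t ≤ min (x.1 + t - p.1) (x.2 + t - p.2) + a := by
          rw [← sub_le_iff_le_add]; exact le_min (by linarith) (by linarith)
        linarith
    have key2 := key.trans (hle _ p hp)
    have hsub : (⨆ q : P, g q x) ≤ (⨆ q : P, g q (x + (t, t))) - t := by
      refine Real.iSup_le (fun q => ?_) ?_
      · refine max_le ?_ ?_
        · have : 0 ≤ 2 * a * ((w p : ℝ) - 1) := by
            have : (0 : ℝ) ≤ w p - 1 := by linarith
            positivity
          linarith
        · by_cases hq : min (x.1 - q.1.1) (x.2 - q.1.2) + a + t ≤ 2 * a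
          · refine (min_le_right _ _).trans ?_
            rw [le_sub_iff_add_le]
            refine le_trans ?_ (hle _ q q.2)
            simp only [hg, Prod.fst_add, Prod.snd_add]
            refine le_max_of_le_right (le_min (by linarith) ?_)
            rw [show min (x.1 + t - q.1.1) (x.2 + t - q.1.2)
              = min (x.1 - q.1.1) (x.2 - q.1.2) + t by rw [← min_add_add_right]; ring_nf]
            linarith
          · push Not at hq
            have e1 := min_le_left (x.1 - q.1.1) (x.2 - q.1.2)
            have e2 := min_le_right (x.1 - q.1.1) (x.2 - q.1.2)
            have := hlt p hp q q.2 ⟨by linarith, by linarith⟩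
            have h5 : (w q : ℝ) + 1 ≤ w p := by exact_mod_cast this
            refine (min_le_left _ _).trans ?_
            have : 2 * a * (w q : ℝ) ≤ 2 * a * (w p - 1) := by
              gcongr; linarith
            linarith
      · have : 0 ≤ 2 * a * ((w p : ℝ) - 1) := by
          have : (0 : ℝ) ≤ w p - 1 := by linarith
          positivity
        linarith
    simpa [le_sub_iff_add_le] using hsub

open scoped Convolution in
/-- Mollification of a bounded continuous function preserves bounds on the function and one-sided
bounds on its directional difference quotients. -/
lemma exists_mollification {E : Type*} [NormedAddCommGroup E] [NormedSpace ℝ E]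
    [FiniteDimensional ℝ E] [MeasurableSpace E] [BorelSpace E]
    (X : E → ℝ) (hX : Continuous X) (M : ℝ) (h0 : ∀ x, 0 ≤ X x) (hM : ∀ x, X x ≤ M)
    (r : ℝ) (hr : 0 < r) :
    ∃ Y : E → ℝ, ContDiff ℝ (⊤ : ℕ∞) Y ∧ (∀ x, |Y x| ≤ M) ∧
      ∀ (x v : E) (b : ℝ), (∀ y ∈ ball x r, ∀ t ∈ Set.Ioo 0 r, X y + t * b ≤ X (y + t • v)) →
        b ≤ fderiv ℝ Y x v := by
  let μ : Measure E := Measure.addHaar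
  let θ : ContDiffBump (0 : E) := ⟨r / 2, r, by positivity, by linarith⟩
  set k := θ.normed μ with hk
  have hk0 : ∀ z, 0 ≤ k z := θ.nonneg_normed
  have hk1 : ∫ z, k z ∂μ = 1 := θ.integral_normed
  have hki : Integrable k μ := θ.integrable_normed
  have hYs : ContDiff ℝ (⊤ : ℕ∞) (k ⋆[ContinuousLinearMap.lsmul ℝ ℝ, μ] X) :=
    θ.hasCompactSupport_normed.contDiff_convolution_left _ θ.contDiff_normed
      hX.locallyIntegrable
  have hprod : ∀ x, Integrable (fun z => k z * X (x - z)) μ := fun x =>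
    hki.mul_bdd (c := M) (by fun_prop) (Filter.Eventually.of_forall fun z => by
      rw [Real.norm_eq_abs, abs_of_nonneg (h0 _)]; exact hM _)
  have hY : ∀ x, (k ⋆[ContinuousLinearMap.lsmul ℝ ℝ, μ] X) x = ∫ z, k z * X (x - z) ∂μ := by
    intro x; rw [convolution_def]; rfl
  set Y := k ⋆[ContinuousLinearMap.lsmul ℝ ℝ, μ] X
  refine ⟨Y, hYs, fun x => ?_, fun x v b h => ?_⟩
  · rw [hY, abs_of_nonneg (integral_nonneg fun z => mul_nonneg (hk0 z) (h0 _))]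
    calc ∫ z, k z * X (x - z) ∂μ ≤ ∫ z, k z * M ∂μ :=
          integral_mono (hprod x) (hki.mul_const M)
            fun z => mul_le_mul_of_nonneg_left (hM _) (hk0 z)
      _ = M := by rw [integral_mul_const, hk1, one_mul]
  · have hd : HasLineDerivAt ℝ Y (fderiv ℝ Y x v) x v :=
      ((hYs.differentiable (by simp)) x).hasFDerivAt.hasLineDerivAt v
    refine ge_of_tendsto hd.tendsto_slope_zero_right ?_
    filter_upwards [Ioo_mem_nhdsGT hr] with t ht
    have key : Y x + t * b ≤ Y (x + t • v) := by
      have e : Y x + t * b = ∫ z, k z * X (x - z) + k z * (t * b) ∂μ := by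
        rw [integral_add (hprod x) (hki.mul_const _), integral_mul_const, hk1, hY, one_mul]
      rw [e, hY]
      refine integral_mono ((hprod x).add (hki.mul_const _)) (hprod _) fun z => ?_
      by_cases hz : z ∈ ball (0 : E) r
      · have := h (x - z) (by simpa [mem_ball_iff_norm] using hz) t ht
        have e2 : x + t • v - z = x - z + t • v := by abel
        rw [e2]
        change k z * X (x - z) + k z * (t * b) ≤ _
        rw [← mul_add]
        exact mul_le_mul_of_nonneg_left this (hk0 z)
      · have : k z = 0 := by
          have : z ∉ Function.support k := by
            rw [hk, θ.support_normed_eq]; exact hz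
          simpa using this
        simp [this]
    have ht0 : 0 < t := ht.1
    rw [smul_eq_mul, le_inv_mul_iff₀ ht0]
    linarith

/-- Smooth version of the staircase function. -/
lemma exists_smooth_staircase (P : Finset (ℝ × ℝ)) (m : ℕ) (w : ℝ × ℝ → ℕ) (h : ℝ) (hh : 0 < h)
    (hw : ∀ p ∈ P, 1 ≤ w p ∧ w p ≤ m)
    (hlt : ∀ p ∈ P, ∀ q ∈ P, q.1 < p.1 ∧ q.2 < p.2 → w q < w p) :
    ∃ Y : ℝ × ℝ → ℝ, ContDiff ℝ (⊤ : ℕ∞) Y ∧ (∀ x, |Y x| ≤ 10 * h * m) ∧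
      (∀ x, 0 ≤ fderiv ℝ Y x (1, 0)) ∧ (∀ x, 0 ≤ fderiv ℝ Y x (0, 1)) ∧
      (∀ x, fderiv ℝ Y x (1, 0) + fderiv ℝ Y x (0, 1) ≤ 1) ∧
      ∀ p ∈ P, ∀ x ∈ ball p (3 * h), 1 ≤ fderiv ℝ Y x (1, 0) + fderiv ℝ Y x (0, 1) := by
  obtain ⟨X, hX0, hmono, hup, hlow⟩ := exists_staircase P m w (5 * h) (by positivity) hw hlt
  have hlip : ∀ x y, X y ≤ X x + dist x y := by
    intro x y
    refine le_trans (hmono y (x + (dist x y, dist x y)) ?_) (hup x _ dist_nonneg)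
    have h1 : dist x.1 y.1 ≤ dist x y := le_max_left _ _
    have h2 : dist x.2 y.2 ≤ dist x y := le_max_right _ _
    rw [Real.dist_eq] at h1 h2
    constructor
    · simp only [Prod.fst_add]; linarith [(abs_le.1 h1).1]
    · simp only [Prod.snd_add]; linarith [(abs_le.1 h2).1]
  have hcont : Continuous X := by
    refine (LipschitzWith.of_dist_le_mul (K := 1) fun x y => ?_).continuous
    rw [Real.dist_eq, abs_le, NNReal.coe_one, one_mul]
    have := hlip x y
    have h2 := hlip y x
    rw [dist_comm] at h2
    constructor <;> linarith
  obtain ⟨Y, hYs, hYM, hY⟩ := exists_mollification X hcont (2 * (5 * h) * m) (fun x => (hX0 x).1)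
    (fun x => (hX0 x).2) h hh
  have hadd : ∀ x, fderiv ℝ Y x (1, 0) + fderiv ℝ Y x (0, 1) = fderiv ℝ Y x (1, 1) := by
    intro x; rw [← map_add]; simp
  refine ⟨Y, hYs, fun x => (hYM x).trans (by linarith), fun x => ?_, fun x => ?_, fun x => ?_,
    fun p hp x hx => ?_⟩
  · refine hY x _ 0 fun y _ t ht => ?_
    rw [mul_zero, add_zero]
    refine hmono _ _ ⟨?_, ?_⟩ <;> simp [ht.1.le]
  · refine hY x _ 0 fun y _ t ht => ?_
    rw [mul_zero, add_zero]
    refine hmono _ _ ⟨?_, ?_⟩ <;> simp [ht.1.le]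
  · rw [hadd]
    have := hY x (-(1, 1)) (-1) fun y _ t ht => by
      have := hup (y + t • (-(1, 1))) t ht.1.le
      have e : y + t • (-(1, 1) : ℝ × ℝ) + (t, t) = y := by ext <;> simp
      rw [e] at this
      linarith
    rw [map_neg] at this
    linarith
  · rw [hadd]
    refine hY x _ 1 fun y hy t ht => ?_
    have e : y + t • ((1, 1) : ℝ × ℝ) = y + (t, t) := by ext <;> simp
    rw [e, mul_one]
    have hd : dist y p < 4 * h := by
      have := dist_triangle y x p
      rw [mem_ball] at hx hy
      linarith
    have h1 : dist y.1 p.1 < 4 * h := lt_of_le_of_lt (le_max_left _ _) hd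
    have h2 : dist y.2 p.2 < 4 * h := lt_of_le_of_lt (le_max_right _ _) hd
    rw [Real.dist_eq, abs_lt] at h1 h2
    have := ht.2
    exact hlow p hp y t ht.1.le (by linarith) (by linarith) (by linarith) (by linarith)

/-- A compact set is covered by few squares of equal size, in terms of the area of a
neighbourhood. -/
lemma exists_finset_cover (S : Set (ℝ × ℝ)) (hS : IsCompact S) (h : ℝ) (hh : 0 < h) :
    ∃ P : Finset (ℝ × ℝ), S ⊆ (⋃ p ∈ P, ball p (2 * h)) ∧
      P.card * ENNReal.ofReal (h ^ 2) ≤ volume (cthickening h S) := by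
  classical
  obtain ⟨t, htS, htf, hcov⟩ := hS.finite_cover_balls hh
  lift t to Finset (ℝ × ℝ) using htf
  obtain ⟨P, hP⟩ := (t.powerset.filter
    (fun u : Finset (ℝ × ℝ) => (u : Set (ℝ × ℝ)).Pairwise fun x y => h ≤ dist x y)).exists_maximal ⟨∅, by simp⟩
  have hP1 := hP.prop
  simp only [Finset.mem_filter, Finset.mem_powerset] at hP1
  obtain ⟨hPt, hPs⟩ := hP1
  refine ⟨P, fun x hx => ?_, ?_⟩
  · obtain ⟨y, hy, hxy⟩ := Set.mem_iUnion₂.1 (hcov hx)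
    suffices ∃ p ∈ P, dist y p < h by
      obtain ⟨p, hp, hyp⟩ := this
      refine Set.mem_iUnion₂.2 ⟨p, hp, ?_⟩
      rw [mem_ball] at hxy ⊢
      linarith [dist_triangle x y p]
    by_contra! hcon
    have hyP : y ∉ P := fun hyP => by
      have := hcon y hyP
      rw [dist_self] at this
      linarith
    have hins : insert y P ∈ t.powerset.filter
        (fun u : Finset (ℝ × ℝ) => (u : Set (ℝ × ℝ)).Pairwise fun x y => h ≤ dist x y) := by
      simp only [Finset.mem_filter, Finset.mem_powerset]
      refine ⟨Finset.insert_subset hy hPt, ?_⟩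
      rw [Finset.coe_insert]
      refine hPs.insert fun b hb _ => ⟨hcon b hb, ?_⟩
      rw [dist_comm]; exact hcon b hb
    exact hyP (hP.le_of_ge hins (Finset.subset_insert _ _) (Finset.mem_insert_self _ _))
  · have hvol : ∀ p : ℝ × ℝ, volume (ball p (h / 2)) = ENNReal.ofReal (h ^ 2) := by
      intro p
      rw [← Prod.eta p, ← ball_prod_same, Measure.volume_eq_prod, Measure.prod_prod,
        Real.volume_ball, Real.volume_ball, ← ENNReal.ofReal_mul (by positivity)]
      congr 1; ring
    have hdisj : (P : Set (ℝ × ℝ)).PairwiseDisjoint fun p => ball p (h / 2) := by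
      intro p hp q hq hpq
      refine ball_disjoint_ball ?_
      have := hPs hp hq hpq
      linarith
    calc P.card * ENNReal.ofReal (h ^ 2) = ∑ p ∈ P, volume (ball p (h / 2)) := by
          simp [hvol]
      _ = volume (⋃ p ∈ P, ball p (h / 2)) :=
          (measure_biUnion_finset hdisj fun p _ => measurableSet_ball).symm
      _ ≤ volume (cthickening h S) := by
          refine measure_mono (Set.iUnion₂_subset fun p hp => ?_)
          refine (ball_subset_ball (ε₂ := h) (by linarith)).trans ?_
          refine (ball_subset_thickening (htS (hPt hp)) h).trans (thickening_subset_cthickening _ _)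

/-- Fields with one-sided bounds on their derivatives, whose derivative is bounded below near a
given compact null set of the plane. -/
lemma exists_plane_fields (S : Set (ℝ × ℝ)) (hS : IsCompact S) (h0 : volume S = 0) (ε : ℝ)
    (hε : 0 < ε) :
    ∃ Y Z : ℝ × ℝ → ℝ, ContDiff ℝ (⊤ : ℕ∞) Y ∧ ContDiff ℝ (⊤ : ℕ∞) Z ∧
      (∀ x, |Y x| ≤ ε ∧ |Z x| ≤ ε ∧ 0 ≤ fderiv ℝ Y x (1, 0) ∧ 0 ≤ fderiv ℝ Y x (0, 1) ∧
        fderiv ℝ Y x (1, 0) + fderiv ℝ Y x (0, 1) ≤ 1 ∧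
        0 ≤ fderiv ℝ Z x (1, 0) ∧ fderiv ℝ Z x (0, 1) ≤ 0 ∧
        fderiv ℝ Z x (1, 0) - fderiv ℝ Z x (0, 1) ≤ 1) ∧
      ∃ V : Set (ℝ × ℝ), IsOpen V ∧ S ⊆ V ∧ ∀ x ∈ V,
        1 ≤ fderiv ℝ Y x (1, 0) + fderiv ℝ Y x (0, 1) +
          (fderiv ℝ Z x (1, 0) - fderiv ℝ Z x (0, 1)) := by
  classical
  obtain ⟨h, hh, hhε, hvol⟩ : ∃ h : ℝ, 0 < h ∧ h ≤ ε / 20 ∧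
      volume (cthickening h S) ≤ ENNReal.ofReal ((ε / 20) ^ 2) := by
    have h1 := tendsto_measure_cthickening_of_isCompact (μ := volume) hS
    rw [h0] at h1
    have h2 : ∀ᶠ h in nhdsWithin (0 : ℝ) (Set.Ioi 0),
        volume (cthickening h S) ≤ ENNReal.ofReal ((ε / 20) ^ 2) :=
      (h1.mono_left nhdsWithin_le_nhds).eventually_le_const
        (ENNReal.ofReal_pos.2 (by positivity))
    obtain ⟨h, h3, h4⟩ := (h2.and (Ioc_mem_nhdsGT (show (0 : ℝ) < ε / 20 by positivity))).exists
    exact ⟨h, h4.1, h4.2, h3⟩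
  obtain ⟨P, hcov, hcard⟩ := exists_finset_cover S hS h hh
  set k := Nat.sqrt P.card with hk
  have hPk : P.card ≤ (k + 1) ^ 2 := (Nat.lt_succ_sqrt' _).le
  have hm : 10 * h * ((k + 1 : ℕ) : ℝ) ≤ ε := by
    have h1 : (P.card : ℝ) * h ^ 2 ≤ (ε / 20) ^ 2 := by
      have := hcard.trans hvol
      rw [← ENNReal.ofReal_natCast, ← ENNReal.ofReal_mul (by positivity),
        ENNReal.ofReal_le_ofReal_iff (by positivity)] at this
      exact this
    have h2 : ((k : ℝ)) ^ 2 ≤ P.card := by exact_mod_cast Nat.sqrt_le' P.card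
    have h3 : (k * h) ^ 2 ≤ (ε / 20) ^ 2 := by
      rw [mul_pow]
      exact (mul_le_mul_of_nonneg_right h2 (by positivity)).trans h1
    have h4 : k * h ≤ ε / 20 := le_of_sq_le_sq h3 (by positivity)
    push_cast
    linarith
  let r : ℝ × ℝ → ℝ × ℝ → Prop := fun q p => q.1 < p.1 ∧ q.2 < p.2
  let s : ℝ × ℝ → ℝ × ℝ → Prop := fun q p => q.1 < p.1 ∧ p.2 < q.2
  have : IsStrictOrder (ℝ × ℝ) r :=
    { irrefl := fun a ha => lt_irrefl _ ha.1
      trans := fun a b c h1 h2 => ⟨h1.1.trans h2.1, h1.2.trans h2.2⟩ }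
  have : IsStrictOrder (ℝ × ℝ) s :=
    { irrefl := fun a ha => lt_irrefl _ ha.1
      trans := fun a b c h1 h2 => ⟨h1.1.trans h2.1, h2.2.trans h1.2⟩ }
  obtain ⟨A, B, v, w, hAB, hv, hv', hw, hw'⟩ := exists_two_ranks r s
    (fun p q hr => ⟨fun hs => lt_asymm hr.2 hs.2, fun hs => lt_asymm hr.1 hs.1⟩) P (k + 1) hPk
  obtain ⟨Y, hYs, hYM, hY1, hY2, hY3, hY4⟩ := exists_smooth_staircase A (k + 1) v h hh hv hv'
  let R : ℝ × ℝ →L[ℝ] ℝ × ℝ :=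
    (ContinuousLinearMap.fst ℝ ℝ ℝ).prod (-ContinuousLinearMap.snd ℝ ℝ ℝ)
  have hR : ∀ x, R x = (x.1, -x.2) := fun x => rfl
  have hRR : ∀ x, R (R x) = x := fun x => by simp [hR]
  obtain ⟨Z, hZs, hZM, hZ1, hZ2, hZ3, hZ4⟩ := exists_smooth_staircase (B.image R) (k + 1)
    (fun p => w (R p)) h hh
    (by
      intro p hp
      obtain ⟨q, hq, rfl⟩ := Finset.mem_image.1 hp
      simpa only [hRR] using hw q hq)
    (by
      intro p hp q hq hqp
      obtain ⟨p₀, hp₀, rfl⟩ := Finset.mem_image.1 hp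
      obtain ⟨q₀, hq₀, rfl⟩ := Finset.mem_image.1 hq
      simp only [hRR]
      refine hw' p₀ hp₀ q₀ hq₀ ?_
      simpa [hR, s] using hqp)
  have hZd : ∀ x u, fderiv ℝ (fun y => Z (R y)) x u = fderiv ℝ Z (R x) (R u) := by
    intro x u
    have : HasFDerivAt (fun y => Z (R y)) ((fderiv ℝ Z (R x)).comp R) x :=
      HasFDerivAt.comp x ((hZs.differentiable (by simp)) (R x)).hasFDerivAt R.hasFDerivAt
    rw [this.fderiv]; rfl
  have e1 : R (1, 0) = (1, 0) := by simp [hR]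
  have e2 : R (0, 1) = -(0, 1) := by simp [hR]
  refine ⟨Y, fun x => Z (R x), hYs, hZs.comp R.contDiff, fun x => ?_,
    ⋃ p ∈ P, ball p (3 * h), isOpen_biUnion fun _ _ => isOpen_ball,
    hcov.trans (Set.iUnion₂_mono fun p _ => ball_subset_ball (by linarith)), fun x hx => ?_⟩
  · rw [hZd, hZd, e1, e2, map_neg]
    refine ⟨(hYM x).trans hm, (hZM _).trans hm, hY1 x, hY2 x, hY3 x, hZ1 _, ?_, ?_⟩
    · linarith [hZ2 (R x)]
    · linarith [hZ3 (R x)]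
  · rw [hZd, hZd, e1, e2, map_neg]
    obtain ⟨p, hp, hxp⟩ := Set.mem_iUnion₂.1 hx
    rw [← hAB, Finset.mem_union] at hp
    rcases hp with hp | hp
    · linarith [hY4 p hp x hxp, hZ1 (R x), hZ2 (R x)]
    · have : R x ∈ ball (R p) (3 * h) := by
        rw [mem_ball] at hxp ⊢
        rw [hR, hR, Prod.dist_eq] at *
        rwa [dist_neg_neg]
      linarith [hZ4 (R p) (Finset.mem_image_of_mem _ hp) (R x) this, hY1 x, hY2 x]

/-- The embedding of the plane as the coordinate plane of the `i`-th and `j`-th coordinates. -/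
noncomputable def planeEmb {d : ℕ} (i j : Fin d) : ℝ × ℝ →L[ℝ] EuclideanSpace ℝ (Fin d) :=
  (ContinuousLinearMap.fst ℝ ℝ ℝ).smulRight (EuclideanSpace.single i 1) +
    (ContinuousLinearMap.snd ℝ ℝ ℝ).smulRight (EuclideanSpace.single j 1)

/-- The pair formed by the `i`-th and the `j`-th coordinate. -/
noncomputable def planeCoord {d : ℕ} (i j : Fin d) : EuclideanSpace ℝ (Fin d) →L[ℝ] ℝ × ℝ :=
  (EuclideanSpace.proj i).prod (EuclideanSpace.proj j)

/-- The projection setting the `i`-th and the `j`-th coordinate to zero. -/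
noncomputable def planeProj {d : ℕ} (i j : Fin d) :
    EuclideanSpace ℝ (Fin d) →L[ℝ] EuclideanSpace ℝ (Fin d) :=
  ContinuousLinearMap.id ℝ _ - (planeEmb i j).comp (planeCoord i j)

section plane

variable {d : ℕ} {i j : Fin d}

lemma planeEmb_one_zero : planeEmb i j (1, 0) = EuclideanSpace.single i 1 := by
  simp [planeEmb]

lemma planeEmb_zero_one : planeEmb i j (0, 1) = EuclideanSpace.single j 1 := by
  simp [planeEmb]

lemma planeCoord_planeEmb (hij : i ≠ j) (p : ℝ × ℝ) : planeCoord i j (planeEmb i j p) = p := by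
  ext <;> simp [planeCoord, planeEmb, hij, hij.symm]

lemma planeProj_add (x : EuclideanSpace ℝ (Fin d)) :
    planeProj i j x + planeEmb i j (planeCoord i j x) = x := by
  simp [planeProj]

lemma planeProj_planeEmb (hij : i ≠ j) (p : ℝ × ℝ) : planeProj i j (planeEmb i j p) = 0 := by
  simp [planeProj, planeCoord_planeEmb hij]

lemma planeCoord_planeProj (hij : i ≠ j) (x : EuclideanSpace ℝ (Fin d)) :
    planeCoord i j (planeProj i j x) = 0 := by
  simp [planeProj, planeCoord_planeEmb hij]

/-- Partial derivatives in the directions of a coordinate plane of a function glued from functions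
on that plane. -/
lemma fderiv_glue_planeEmb (hij : i ≠ j) {κ : Type*} [Fintype κ]
    (χ : κ → EuclideanSpace ℝ (Fin d) → ℝ) (F : κ → ℝ × ℝ → ℝ)
    (hχ : ∀ a, ContDiff ℝ (⊤ : ℕ∞) (χ a)) (hF : ∀ a, ContDiff ℝ (⊤ : ℕ∞) (F a))
    (x : EuclideanSpace ℝ (Fin d)) (p : ℝ × ℝ) :
    fderiv ℝ (fun x => ∑ a, χ a (planeProj i j x) * F a (planeCoord i j x)) x (planeEmb i j p) =
      ∑ a, χ a (planeProj i j x) * fderiv ℝ (F a) (planeCoord i j x) p := by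
  have h : ∀ a, HasFDerivAt (fun x => χ a (planeProj i j x) * F a (planeCoord i j x))
      (χ a (planeProj i j x) • ((fderiv ℝ (F a) (planeCoord i j x)).comp (planeCoord i j)) +
        F a (planeCoord i j x) • ((fderiv ℝ (χ a) (planeProj i j x)).comp (planeProj i j))) x := by
    intro a
    have h1 : HasFDerivAt (fun x => χ a (planeProj i j x))
        ((fderiv ℝ (χ a) (planeProj i j x)).comp (planeProj i j)) x :=
      HasFDerivAt.comp x (((hχ a).differentiable (by simp)) _).hasFDerivAt
        (planeProj i j).hasFDerivAt
    have h2 : HasFDerivAt (fun x => F a (planeCoord i j x))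
        ((fderiv ℝ (F a) (planeCoord i j x)).comp (planeCoord i j)) x :=
      HasFDerivAt.comp x (((hF a).differentiable (by simp)) _).hasFDerivAt
        (planeCoord i j).hasFDerivAt
    exact h1.mul h2
  have hs := HasFDerivAt.fun_sum (u := Finset.univ) fun a _ => h a
  rw [hs.fderiv]
  simp [planeCoord_planeEmb hij, planeProj_planeEmb hij]

open scoped Manifold ContDiff in
/-- Fields on `ℝ^d` with one-sided bounds on their derivatives in the directions of a coordinate
plane, whose derivative is bounded below on a given compact set with null slices. -/
lemma exists_fields (hij : i ≠ j) (K : Set (EuclideanSpace ℝ (Fin d))) (hK : IsCompact K)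
    (hslice : ∀ x ∈ K, volume {p : ℝ × ℝ | x + planeEmb i j p ∈ K} = 0) (ε : ℝ) (hε : 0 < ε) :
    ∃ Y Z : EuclideanSpace ℝ (Fin d) → ℝ,
      ContDiff ℝ (⊤ : ℕ∞) Y ∧ ContDiff ℝ (⊤ : ℕ∞) Z ∧
      (∀ x, |Y x| ≤ ε ∧ |Z x| ≤ ε ∧ 0 ≤ pderiv' i Y x ∧ 0 ≤ pderiv' j Y x ∧
        pderiv' i Y x + pderiv' j Y x ≤ 1 ∧
        0 ≤ pderiv' i Z x ∧ pderiv' j Z x ≤ 0 ∧ pderiv' i Z x - pderiv' j Z x ≤ 1) ∧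
      ∀ x ∈ K, 1 ≤ pderiv' i Y x + pderiv' j Y x + (pderiv' i Z x - pderiv' j Z x) := by
  classical
  set π := planeProj i j
  set q := planeCoord i j
  set C := π '' K with hC
  have hCc : IsCompact C := hK.image π.continuous
  have hS : ∀ y : C, IsCompact {p : ℝ × ℝ | (y : EuclideanSpace ℝ (Fin d)) + planeEmb i j p ∈ K} ∧
      volume {p : ℝ × ℝ | (y : EuclideanSpace ℝ (Fin d)) + planeEmb i j p ∈ K} = 0 := by
    rintro ⟨_, x, hx, rfl⟩
    constructor
    · refine (hK.image q.continuous).of_isClosed_subset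
        (hK.isClosed.preimage (by fun_prop)) fun p hp => ⟨_, hp, ?_⟩
      simp only [map_add, q, π, planeCoord_planeEmb hij, planeCoord_planeProj hij, zero_add]
    · rw [← hslice x hx, ← measure_preimage_add_right volume (q x)]
      congr 1
      ext p
      simp only [Set.mem_preimage, Set.mem_ofPred_eq, map_add]
      have h : x = π x + planeEmb i j (q x) := (planeProj_add x).symm
      rw [add_left_comm, ← h, add_comm]
  choose Y Z hY hZ hYZ V hVo hSV hV using fun y : C =>
    exists_plane_fields _ (hS y).1 (hS y).2 ε hε
  let U : C → Set (EuclideanSpace ℝ (Fin d)) := fun y => (π '' {x ∈ K | q x ∉ V y})ᶜ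
  have hUo : ∀ y, IsOpen (U y) := fun y => by
    refine IsClosed.isOpen_compl (self := ?_)
    refine (IsCompact.image (hK.of_isClosed_subset ?_ fun x hx => hx.1) π.continuous).isClosed
    exact hK.isClosed.inter ((hVo y).isClosed_compl.preimage q.continuous)
  have hUC : C ⊆ ⋃ y, U y := by
    intro y hy
    refine Set.mem_iUnion.2 ⟨⟨y, hy⟩, ?_⟩
    rintro ⟨x, ⟨hxK, hxV⟩, hxy⟩
    refine hxV (hSV _ ?_)
    change y + planeEmb i j (q x) ∈ K
    rw [← hxy, planeProj_add]
    exact hxK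
  obtain ⟨t, ht⟩ := hCc.elim_finite_subcover U hUo hUC
  obtain ⟨χ, hχ⟩ := SmoothPartitionOfUnity.exists_isSubordinate 𝓘(ℝ, EuclideanSpace ℝ (Fin d))
    hCc.isClosed (fun y : t => U y) (fun y => hUo y) (by
      intro y hy
      obtain ⟨z, hz, hyz⟩ := Set.mem_iUnion₂.1 (ht hy)
      exact Set.mem_iUnion.2 ⟨⟨z, hz⟩, hyz⟩)
  have hχs : ∀ a, ContDiff ℝ (⊤ : ℕ∞) (χ a) := fun a => (χ a).contMDiff.contDiff
  have hχ0 : ∀ a x, 0 ≤ χ a x := χ.nonneg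
  have hχ1 : ∀ x, ∑ a, χ a x ≤ 1 := fun x => by
    rw [← finsum_eq_sum_of_fintype]; exact χ.sum_le_one x
  have hχC : ∀ x ∈ C, ∑ a, χ a x = 1 := fun x hx => by
    rw [← finsum_eq_sum_of_fintype]; exact χ.sum_eq_one hx
  have hdi : ∀ (F : C → ℝ × ℝ → ℝ) (hF : ∀ y, ContDiff ℝ (⊤ : ℕ∞) (F y)) (x),
      pderiv' i (fun x => ∑ a, χ a (π x) * F a (q x)) x =
        ∑ a, χ a (π x) * fderiv ℝ (F a) (q x) (1, 0) := fun F hF x => by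
    rw [pderiv', ← planeEmb_one_zero (i := i) (j := j)]
    exact fderiv_glue_planeEmb hij (fun a => χ a) (fun a : t => F a) hχs (fun a => hF a) x _
  have hdj : ∀ (F : C → ℝ × ℝ → ℝ) (hF : ∀ y, ContDiff ℝ (⊤ : ℕ∞) (F y)) (x),
      pderiv' j (fun x => ∑ a, χ a (π x) * F a (q x)) x =
        ∑ a, χ a (π x) * fderiv ℝ (F a) (q x) (0, 1) := fun F hF x => by
    rw [pderiv', ← planeEmb_zero_one (i := i) (j := j)]
    exact fderiv_glue_planeEmb hij (fun a => χ a) (fun a : t => F a) hχs (fun a => hF a) x _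
  have hsm : ∀ (F : C → ℝ × ℝ → ℝ) (hF : ∀ y, ContDiff ℝ (⊤ : ℕ∞) (F y)),
      ContDiff ℝ (⊤ : ℕ∞) (fun x => ∑ a, χ a (π x) * F a (q x)) := fun F hF =>
    ContDiff.sum fun a _ => ((hχs a).comp π.contDiff).mul ((hF a).comp q.contDiff)
  have hle : ∀ (f : C → ℝ) (c : ℝ) (x), 0 ≤ c → (∀ a, f a ≤ c) →
      ∑ a : t, χ a (π x) * f a ≤ c := fun f c x hc hf => by
    calc ∑ a : t, χ a (π x) * f a ≤ ∑ a : t, χ a (π x) * c :=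
          Finset.sum_le_sum fun a _ => mul_le_mul_of_nonneg_left (hf a) (hχ0 a _)
      _ ≤ c := by
          rw [← Finset.sum_mul]
          exact mul_le_of_le_one_left hc (hχ1 _)
  have habs : ∀ (f : C → ℝ) (x), (∀ a, |f a| ≤ ε) → |∑ a : t, χ a (π x) * f a| ≤ ε :=
    fun f x hf => by
    refine abs_le.2 ⟨?_, hle f ε x hε.le fun a => (abs_le.1 (hf a)).2⟩
    have := hle (fun a => - f a) ε x hε.le fun a => by linarith [(abs_le.1 (hf a)).1]
    simp only [mul_neg, Finset.sum_neg_distrib] at this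
    linarith
  refine ⟨fun x => ∑ a, χ a (π x) * Y a (q x), fun x => ∑ a, χ a (π x) * Z a (q x),
    hsm _ hY, hsm _ hZ, fun x => ?_, fun x hx => ?_⟩
  · rw [hdi _ hY, hdj _ hY, hdi _ hZ, hdj _ hZ, ← Finset.sum_add_distrib, ← Finset.sum_sub_distrib]
    simp only [← mul_add, ← mul_sub]
    refine ⟨habs (fun a => Y a (q x)) x fun a => (hYZ a _).1,
      habs (fun a => Z a (q x)) x fun a => (hYZ a _).2.1,
      Finset.sum_nonneg fun a _ => mul_nonneg (hχ0 a _) (hYZ a _).2.2.1,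
      Finset.sum_nonneg fun a _ => mul_nonneg (hχ0 a _) (hYZ a _).2.2.2.1,
      hle (fun a => fderiv ℝ (Y a) (q x) (1, 0) + fderiv ℝ (Y a) (q x) (0, 1)) 1 x zero_le_one
        fun a => (hYZ a _).2.2.2.2.1,
      Finset.sum_nonneg fun a _ => mul_nonneg (hχ0 a _) (hYZ a _).2.2.2.2.2.1,
      Finset.sum_nonpos fun a _ => mul_nonpos_of_nonneg_of_nonpos (hχ0 a _)
        (hYZ a _).2.2.2.2.2.2.1,
      hle (fun a => fderiv ℝ (Z a) (q x) (1, 0) - fderiv ℝ (Z a) (q x) (0, 1)) 1 x zero_le_one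
        fun a => (hYZ a _).2.2.2.2.2.2.2⟩
  · rw [hdi _ hY, hdj _ hY, hdi _ hZ, hdj _ hZ, ← Finset.sum_add_distrib,
      ← Finset.sum_sub_distrib, ← Finset.sum_add_distrib]
    refine (hχC (π x) ⟨x, hx, rfl⟩).symm.le.trans ?_
    refine Finset.sum_le_sum fun a _ => ?_
    simp only [← mul_add, ← mul_sub]
    by_cases ha : χ a (π x) = 0
    · simp [ha]
    · refine le_mul_of_one_le_right (hχ0 a _) (hV a _ ?_)
      by_contra hq
      exact hχ a (subset_tsupport _ ha) ⟨x, ⟨hx, hq⟩, rfl⟩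

end plane

section calculus

variable {d : ℕ}

lemma contDiff_pderiv' (j : Fin d) {φ : EuclideanSpace ℝ (Fin d) → ℝ}
    (hφ : ContDiff ℝ (⊤ : ℕ∞) φ) : ContDiff ℝ (⊤ : ℕ∞) (pderiv' j φ) :=
  (hφ.fderiv_right (m := (⊤ : ℕ∞)) (by simp)).clm_apply contDiff_const

lemma tsupport_pderiv'_subset (j : Fin d) (φ : EuclideanSpace ℝ (Fin d) → ℝ) :
    tsupport (pderiv' j φ) ⊆ tsupport φ :=
  tsupport_fderiv_apply_subset ℝ _

lemma hasCompactSupport_pderiv' (j : Fin d) {φ : EuclideanSpace ℝ (Fin d) → ℝ}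
    (hφ : HasCompactSupport φ) : HasCompactSupport (pderiv' j φ) :=
  hφ.fderiv_apply ℝ _

lemma pderiv'_mul (j : Fin d) {φ ψ : EuclideanSpace ℝ (Fin d) → ℝ}
    (hφ : ContDiff ℝ (⊤ : ℕ∞) φ) (hψ : ContDiff ℝ (⊤ : ℕ∞) ψ) (x : EuclideanSpace ℝ (Fin d)) :
    pderiv' j (fun x => φ x * ψ x) x = φ x * pderiv' j ψ x + ψ x * pderiv' j φ x := by
  rw [pderiv', fderiv_fun_mul (hφ.differentiable (by simp) x) (hψ.differentiable (by simp) x)]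
  simp [pderiv']

lemma pderiv'_comm (i j : Fin d) {φ : EuclideanSpace ℝ (Fin d) → ℝ}
    (hφ : ContDiff ℝ (⊤ : ℕ∞) φ) : pderiv' i (pderiv' j φ) = pderiv' j (pderiv' i φ) := by
  ext x
  have h : ∀ k l : Fin d, pderiv' k (pderiv' l φ) x =
      fderiv ℝ (fderiv ℝ φ) x (EuclideanSpace.single k 1) (EuclideanSpace.single l 1) := by
    intro k l
    have h1 : DifferentiableAt ℝ (fderiv ℝ φ) x :=
      (hφ.fderiv_right (m := (⊤ : ℕ∞)) (by simp)).differentiable (by simp) x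
    have h2 : HasFDerivAt (pderiv' l φ) _ x :=
      h1.hasFDerivAt.clm_apply (hasFDerivAt_const (EuclideanSpace.single l (1 : ℝ)) x)
    rw [pderiv', h2.fderiv]
    simp
  rw [h, h]
  exact (hφ.contDiffAt.isSymmSndFDerivAt (by
    simpa using (by exact_mod_cast le_top : ((2 : ℕ∞) : WithTop ℕ∞) ≤ ((⊤ : ℕ∞) : WithTop ℕ∞)))).eq _ _

open scoped Manifold ContDiff in
/-- Smooth cutoff functions between a compact set and an open set. -/
lemma exists_cutoff {K G : Set (EuclideanSpace ℝ (Fin d))} (hK : IsCompact K) (hG : IsOpen G)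
    (hKG : K ⊆ G) : ∃ φ : EuclideanSpace ℝ (Fin d) → ℝ, ContDiff ℝ (⊤ : ℕ∞) φ ∧
      HasCompactSupport φ ∧ tsupport φ ⊆ G ∧ (∀ x, 0 ≤ φ x ∧ φ x ≤ 1) ∧ ∀ x ∈ K, φ x = 1 := by
  obtain ⟨K', hK', hKK', hK'G⟩ := exists_compact_between hK hG hKG
  obtain ⟨φ, hφ, hr, hs, h1⟩ := exists_contMDiff_support_eq_eq_one_iff
    (I := 𝓘(ℝ, EuclideanSpace ℝ (Fin d))) (n := (⊤ : ℕ∞)) isOpen_interior hK.isClosed hKK'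
  have ht : tsupport φ ⊆ K' :=
    closure_minimal (hs.subset.trans interior_subset) hK'.isClosed
  refine ⟨φ, hφ.contDiff, hK'.of_isClosed_subset (isClosed_tsupport _) ht, ht.trans hK'G,
    fun x => hr ⟨x, rfl⟩, fun x hx => (h1 x).1 hx⟩

end calculus

section curl

variable {d : ℕ} {i j : Fin d}

lemma integrable_mul_of_hasCompactSupport {ρ : Measure (EuclideanSpace ℝ (Fin d))}
    [IsFiniteMeasure ρ] {g φ : EuclideanSpace ℝ (Fin d) → ℝ} (hg : Integrable g ρ)
    (hφ : Continuous φ) (hφc : HasCompactSupport φ) : Integrable (fun x => φ x * g x) ρ := by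
  obtain ⟨c, hc⟩ := hφc.exists_bound_of_continuous hφ
  exact hg.bdd_mul hφ.aestronglyMeasurable (.of_forall hc)

/-- Two planar fields which are curl-free with respect to `ρ` cannot be transversal on a compact
set with null slices of positive `ρ`-measure. -/
lemma measure_eq_zero_of_curl_free (hij : i ≠ j) {Ω : Set (EuclideanSpace ℝ (Fin d))}
    (hΩ : IsOpen Ω) (ρ : Measure (EuclideanSpace ℝ (Fin d))) [IsFiniteMeasure ρ]
    {F₁ F₂ H₁ H₂ : EuclideanSpace ℝ (Fin d) → ℝ} {C : ℝ} (hC : 1 ≤ C)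
    (hF₁m : AEStronglyMeasurable F₁ ρ) (hF₂m : AEStronglyMeasurable F₂ ρ)
    (hH₁m : AEStronglyMeasurable H₁ ρ) (hH₂m : AEStronglyMeasurable H₂ ρ)
    (hF₁ : ∀ᵐ x ∂ρ, |F₁ x| ≤ C) (hF₂ : ∀ᵐ x ∂ρ, |F₂ x| ≤ C)
    (hH₁ : ∀ᵐ x ∂ρ, |H₁ x| ≤ C) (hH₂ : ∀ᵐ x ∂ρ, |H₂ x| ≤ C)
    (hF : ∀ ψ : EuclideanSpace ℝ (Fin d) → ℝ, ContDiff ℝ (⊤ : ℕ∞) ψ → HasCompactSupport ψ →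
      tsupport ψ ⊆ Ω → ∫ x, pderiv' j ψ x * F₁ x ∂ρ = ∫ x, pderiv' i ψ x * F₂ x ∂ρ)
    (hH : ∀ ψ : EuclideanSpace ℝ (Fin d) → ℝ, ContDiff ℝ (⊤ : ℕ∞) ψ → HasCompactSupport ψ →
      tsupport ψ ⊆ Ω → ∫ x, pderiv' j ψ x * H₁ x ∂ρ = ∫ x, pderiv' i ψ x * H₂ x ∂ρ)
    {K : Set (EuclideanSpace ℝ (Fin d))} (hK : IsCompact K) (hKΩ : K ⊆ Ω)
    (hslice : ∀ x ∈ K, volume {p : ℝ × ℝ | x + planeEmb i j p ∈ K} = 0)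
    (hKF : ∀ x ∈ K, 1 / 2 ≤ F₁ x ∧ F₂ x ≤ -(1 / 2) ∧ 1 / 2 ≤ H₁ x ∧ 1 / 2 ≤ H₂ x) :
    ρ K = 0 := by
  by_contra hρK
  have hm : 0 < ρ.real K := ENNReal.toReal_pos hρK (measure_ne_top _ _)
  set δ : ℝ := ρ.real K / (8 * C) with hδ
  have hδ0 : 0 < δ := by positivity
  obtain ⟨U, hKU, hU, hUδ⟩ := K.exists_isOpen_lt_add (measure_ne_top ρ _)
    (ε := ENNReal.ofReal δ) (by simpa)
  have hUr : ρ.real U < ρ.real K + δ := by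
    rw [Measure.real, Measure.real, ← ENNReal.toReal_ofReal hδ0.le,
      ← ENNReal.toReal_add (measure_ne_top _ _) ENNReal.ofReal_ne_top]
    exact (ENNReal.toReal_lt_toReal (measure_ne_top _ _) (by simp)).2 hUδ
  have hG : ρ.real ((U ∩ Ω) \ K) ≤ δ := by
    have : ρ.real (U \ K) = ρ.real U - ρ.real K := measureReal_sdiff hKU hK.measurableSet
    have := measureReal_mono (μ := ρ) (show (U ∩ Ω) \ K ⊆ U \ K by gcongr; simp)
    linarith
  obtain ⟨φ, hφ, hφc, hφG, hφ01, hφ1⟩ :=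
    exists_cutoff hK (hU.inter hΩ) (Set.subset_inter hKU hKΩ)
  have hF₁i : Integrable F₁ ρ := .of_bound hF₁m C hF₁
  have hF₂i : Integrable F₂ ρ := .of_bound hF₂m C hF₂
  have hH₁i : Integrable H₁ ρ := .of_bound hH₁m C hH₁
  have hH₂i : Integrable H₂ ρ := .of_bound hH₂m C hH₂
  have hpc : ∀ k, Continuous (pderiv' k φ) := fun k => (contDiff_pderiv' k hφ).continuous
  have hpi : ∀ k, Integrable (fun x => |pderiv' k φ x|) ρ := fun k =>
    ((hpc k).integrable_of_hasCompactSupport (hasCompactSupport_pderiv' k hφc)).abs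
  set M : ℝ := ∫ x, (|pderiv' i φ x| + |pderiv' j φ x|) ∂ρ with hM
  have hM0 : 0 ≤ M := integral_nonneg fun x => by positivity
  have key : ∀ (Y F₁ F₂ : EuclideanSpace ℝ (Fin d) → ℝ) (ε : ℝ), 0 < ε →
      ContDiff ℝ (⊤ : ℕ∞) Y → (∀ x, |Y x| ≤ ε) → Integrable F₁ ρ → Integrable F₂ ρ →
      (∀ᵐ x ∂ρ, |F₁ x| ≤ C) → (∀ᵐ x ∂ρ, |F₂ x| ≤ C) →
      (∀ ψ : EuclideanSpace ℝ (Fin d) → ℝ, ContDiff ℝ (⊤ : ℕ∞) ψ → HasCompactSupport ψ →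
        tsupport ψ ⊆ Ω → ∫ x, pderiv' j ψ x * F₁ x ∂ρ = ∫ x, pderiv' i ψ x * F₂ x ∂ρ) →
      Integrable (fun x => φ x * (pderiv' j Y x * F₁ x - pderiv' i Y x * F₂ x)) ρ ∧
      |∫ x, φ x * (pderiv' j Y x * F₁ x - pderiv' i Y x * F₂ x) ∂ρ| ≤ ε * C * M := by
    intro Y F₁ F₂ ε hε hY hYε hF₁i hF₂i hF₁ hF₂ hF
    have hψ : ContDiff ℝ (⊤ : ℕ∞) (fun x => φ x * Y x) := hφ.mul hY
    have hψc : HasCompactSupport (fun x => φ x * Y x) := hφc.mul_right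
    have hψG : tsupport (fun x => φ x * Y x) ⊆ Ω :=
      (tsupport_mul_subset_left.trans hφG).trans Set.inter_subset_right
    have hprod : ∀ (k : Fin d) (F : EuclideanSpace ℝ (Fin d) → ℝ), Integrable F ρ →
        Integrable (fun x => φ x * pderiv' k Y x * F x) ρ ∧
        Integrable (fun x => Y x * pderiv' k φ x * F x) ρ := fun k F hFi =>
      ⟨integrable_mul_of_hasCompactSupport hFi
        (hφ.continuous.mul (contDiff_pderiv' k hY).continuous) hφc.mul_right,
      integrable_mul_of_hasCompactSupport hFi
        (hY.continuous.mul (hpc k)) (hasCompactSupport_pderiv' k hφc).mul_left⟩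
    have h := hF _ hψ hψc hψG
    simp only [pderiv'_mul _ hφ hY, add_mul] at h
    rw [integral_add (hprod j F₁ hF₁i).1 (hprod j F₁ hF₁i).2,
      integral_add (hprod i F₂ hF₂i).1 (hprod i F₂ hF₂i).2] at h
    have heq : (fun x => φ x * (pderiv' j Y x * F₁ x - pderiv' i Y x * F₂ x)) =
        fun x => φ x * pderiv' j Y x * F₁ x - φ x * pderiv' i Y x * F₂ x := by
      ext x; ring
    rw [heq]
    refine ⟨(hprod j F₁ hF₁i).1.sub (hprod i F₂ hF₂i).1, ?_⟩
    rw [integral_sub (hprod j F₁ hF₁i).1 (hprod i F₂ hF₂i).1]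
    have h2 : ∫ x, φ x * pderiv' j Y x * F₁ x ∂ρ - ∫ x, φ x * pderiv' i Y x * F₂ x ∂ρ =
        ∫ x, (Y x * pderiv' i φ x * F₂ x - Y x * pderiv' j φ x * F₁ x) ∂ρ := by
      rw [integral_sub (hprod i F₂ hF₂i).2 (hprod j F₁ hF₁i).2]; linarith
    rw [h2, ← Real.norm_eq_abs, hM, ← integral_const_mul]
    refine norm_integral_le_of_norm_le (((hpi i).add (hpi j)).const_mul _) ?_
    filter_upwards [hF₁, hF₂] with x h1 h2
    have hb : ∀ a b : ℝ, |b| ≤ C → |Y x * a * b| ≤ ε * C * |a| := fun a b hb => by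
      rw [abs_mul, abs_mul]
      calc |Y x| * |a| * |b| ≤ ε * |a| * C := by
            gcongr
            exact hYε x
        _ = _ := by ring
    calc ‖Y x * pderiv' i φ x * F₂ x - Y x * pderiv' j φ x * F₁ x‖
        ≤ |Y x * pderiv' i φ x * F₂ x| + |Y x * pderiv' j φ x * F₁ x| := norm_sub_le _ _
      _ ≤ ε * C * |pderiv' i φ x| + ε * C * |pderiv' j φ x| := add_le_add (hb _ _ h2) (hb _ _ h1)
      _ = _ := by ring
  have hmain : ∀ ε : ℝ, 0 < ε → ρ.real K / 2 - 2 * C * δ ≤ 2 * (ε * C * M) := by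
    intro ε hε
    obtain ⟨Y, Z, hY, hZ, hYZ, hYZK⟩ := exists_fields hij K hK hslice ε hε
    obtain ⟨hiY, hbY⟩ := key Y F₁ F₂ ε hε hY (fun x => (hYZ x).1) hF₁i hF₂i hF₁ hF₂ hF
    obtain ⟨hiZ, hbZ⟩ := key Z H₁ H₂ ε hε hZ (fun x => (hYZ x).2.1) hH₁i hH₂i hH₁ hH₂ hH
    have hlow : ∫ x, (K.indicator (fun _ => (1 / 2 : ℝ)) x -
          ((U ∩ Ω) \ K).indicator (fun _ => 2 * C) x) ∂ρ ≤
        ∫ x, (φ x * (pderiv' j Y x * F₁ x - pderiv' i Y x * F₂ x) -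
          φ x * (pderiv' j Z x * H₁ x - pderiv' i Z x * H₂ x)) ∂ρ := by
      refine integral_mono_ae ?_ (hiY.sub hiZ) ?_
      · exact ((integrable_const _).indicator hK.measurableSet).sub
          ((integrable_const _).indicator ((hU.inter hΩ).measurableSet.diff hK.measurableSet))
      · filter_upwards [hF₁, hF₂, hH₁, hH₂] with x h1 h2 h3 h4
        obtain ⟨-, -, y1, y2, y3, z1, z2, z3⟩ := hYZ x
        by_cases hx : x ∈ K
        · obtain ⟨k1, k2, k3, k4⟩ := hKF x hx
          have := hYZK x hx
          simp only [hx, Set.indicator_of_mem, Set.mem_sdiff, not_true, and_false,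
            not_false_eq_true, Set.indicator_of_notMem, hφ1 x hx]
          nlinarith
        · by_cases hxG : x ∈ U ∩ Ω
          · rw [Set.indicator_of_notMem hx,
              Set.indicator_of_mem (show x ∈ (U ∩ Ω) \ K from ⟨hxG, hx⟩)]
            rw [abs_le] at h1 h2 h3 h4
            have hb : -(2 * C) ≤ pderiv' j Y x * F₁ x - pderiv' i Y x * F₂ x -
                (pderiv' j Z x * H₁ x - pderiv' i Z x * H₂ x) := by
              nlinarith
            have := hφ01 x
            nlinarith
          · have : φ x = 0 := image_eq_zero_of_notMem_tsupport fun h => hxG (hφG h)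
            rw [Set.indicator_of_notMem hx, Set.indicator_of_notMem fun h => hxG h.1, this]
            simp
    rw [integral_sub hiY hiZ, integral_sub ((integrable_const _).indicator hK.measurableSet)
          ((integrable_const _).indicator ((hU.inter hΩ).measurableSet.diff hK.measurableSet)),
      integral_indicator hK.measurableSet, integral_indicator
        ((hU.inter hΩ).measurableSet.diff hK.measurableSet)] at hlow
    simp only [integral_const, smul_eq_mul, measureReal_restrict_apply_univ] at hlow
    have h1 := (abs_le.1 hbY).2
    have h2 := (abs_le.1 hbZ).1
    nlinarith
  have h0 : 2 * C * δ = ρ.real K / 4 := by rw [hδ]; field_simp; norm_num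
  have h1 := hmain (ρ.real K / (16 * C * (M + 1))) (by positivity)
  have h2 : 2 * (ρ.real K / (16 * C * (M + 1)) * C * M) < ρ.real K / 4 := by
    have : 2 * (ρ.real K / (16 * C * (M + 1)) * C * M) = ρ.real K / 8 * (M / (M + 1)) := by
      field_simp; ring
    rw [this]
    have : M / (M + 1) ≤ 1 := (div_le_one (by positivity)).2 (by linarith)
    nlinarith
  linarith

end curl

section slices

variable {d : ℕ} {i j : Fin d}

open scoped Manifold ContDiff in
/-- A measure which is a partial derivative of an integrable function does not charge the null sets
which are invariant in the direction of this derivative. -/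
lemma ae_eq_zero_of_volume_preimage_image_eq_zero {Ω : Set (EuclideanSpace ℝ (Fin d))}
    (hΩ : IsOpen Ω) (ρ : Measure (EuclideanSpace ℝ (Fin d))) [IsFiniteMeasure ρ]
    {w g : EuclideanSpace ℝ (Fin d) → ℝ} (hw : IntegrableOn w Ω volume) (hg : Integrable g ρ)
    {k : Fin d}
    (hwg : ∀ φ : EuclideanSpace ℝ (Fin d) → ℝ, ContDiff ℝ (⊤ : ℕ∞) φ → HasCompactSupport φ →
      tsupport φ ⊆ Ω → ∫ x in Ω, w x * pderiv' k φ x ∂volume = - ∫ x, φ x * g x ∂ρ)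
    (π : EuclideanSpace ℝ (Fin d) →L[ℝ] EuclideanSpace ℝ (Fin d))
    (hπ : π (EuclideanSpace.single k 1) = 0)
    {K : Set (EuclideanSpace ℝ (Fin d))} (hK : IsCompact K) (hKΩ : K ⊆ Ω)
    (hKπ : volume (π ⁻¹' (π '' K)) = 0) : ∀ᵐ x ∂ρ, x ∈ K → g x = 0 := by
  set C := π '' K
  have hC : IsClosed C := (hK.image π.continuous).isClosed
  have hL : MeasurableSet (π ⁻¹' C) := (hC.preimage π.continuous).measurableSet
  have hpos : ∀ n : ℕ, (0 : ℝ) < 1 / (n + 1) := fun n => Nat.one_div_pos_of_nat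
  choose χ hχ hχr hχs hχ1 using fun n : ℕ => exists_contMDiff_support_eq_eq_one_iff
    (I := 𝓘(ℝ, EuclideanSpace ℝ (Fin d))) (n := (⊤ : ℕ∞)) (isOpen_thickening (δ := 1 / ((n : ℝ) + 1))
      (E := C)) hC (self_subset_thickening (hpos n) C)
  have hχd : ∀ n, ContDiff ℝ (⊤ : ℕ∞) (χ n) := fun n => (hχ n).contDiff
  have hχb : ∀ n x, ‖χ n x‖ ≤ 1 := fun n x => by
    obtain ⟨h0, h1⟩ := hχr n ⟨x, rfl⟩
    rwa [Real.norm_of_nonneg h0]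
  have hlim : ∀ x, Filter.Tendsto (fun n => χ n (π x)) Filter.atTop
      (nhds ((π ⁻¹' C).indicator (fun _ => (1 : ℝ)) x)) := by
    intro x
    by_cases hx : π x ∈ C
    · rw [Set.indicator_of_mem (show x ∈ π ⁻¹' C from hx)]
      exact tendsto_const_nhds.congr fun n => ((hχ1 n _).1 hx).symm
    · rw [Set.indicator_of_notMem (show x ∉ π ⁻¹' C from hx)]
      refine tendsto_const_nhds.congr' ?_
      by_cases hne : C.Nonempty
      · have h0 : 0 < infDist (π x) C := (hC.notMem_iff_infDist_pos hne).1 hx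
        filter_upwards [(tendsto_one_div_add_atTop_nhds_zero_nat (𝕜 := ℝ)).eventually_lt_const h0]
          with n hn
        by_contra h
        have : π x ∈ Function.support (χ n) := fun h' => h h'.symm
        rw [hχs, mem_thickening_iff_infDist_lt hne] at this
        exact lt_asymm hn this
      · rw [Set.not_nonempty_iff_eq_empty] at hne
        refine .of_forall fun n => ?_
        by_contra h
        have : π x ∈ Function.support (χ n) := fun h' => h h'.symm
        rw [hχs, hne, thickening_empty] at this
        exact this
  have hχπ : ∀ n x, pderiv' k (fun x => χ n (π x)) x = 0 := fun n x => by
    have h : HasFDerivAt (fun x => χ n (π x)) ((fderiv ℝ (χ n) (π x)).comp π) x :=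
      ((hχd n).differentiable (by simp) (π x)).hasFDerivAt.comp x π.hasFDerivAt
    rw [pderiv', h.fderiv]
    simp [hπ]
  have hzero : ∀ φ : EuclideanSpace ℝ (Fin d) → ℝ, ContDiff ℝ ∞ φ → HasCompactSupport φ →
      tsupport φ ⊆ Ω → ∫ x, φ x • (π ⁻¹' C).indicator g x ∂ρ = 0 := by
    intro φ hφ hφc hφΩ
    have h1 : Filter.Tendsto (fun n => ∫ x, χ n (π x) * (φ x * g x) ∂ρ) Filter.atTop
        (nhds (∫ x, (π ⁻¹' C).indicator (fun _ => (1 : ℝ)) x * (φ x * g x) ∂ρ)) := by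
      have hi := integrable_mul_of_hasCompactSupport hg hφ.continuous hφc
      refine tendsto_integral_of_dominated_convergence (fun x => ‖φ x * g x‖) (fun n => ?_)
        hi.norm (fun n => .of_forall fun x => ?_) (.of_forall fun x => (hlim x).mul_const _)
      · exact ((hχd n).continuous.comp π.continuous).aestronglyMeasurable.mul
          hi.aestronglyMeasurable
      · rw [norm_mul]
        exact mul_le_of_le_one_left (norm_nonneg _) (hχb n _)
    have h2 : Filter.Tendsto (fun n => ∫ x in Ω, χ n (π x) * (w x * pderiv' k φ x)) Filter.atTop
        (nhds (∫ x in Ω, (π ⁻¹' C).indicator (fun _ => (1 : ℝ)) x * (w x * pderiv' k φ x))) := by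
      have hc := (contDiff_pderiv' k hφ).continuous
      obtain ⟨c, hc'⟩ := (hasCompactSupport_pderiv' k hφc).exists_bound_of_continuous hc
      have hi : IntegrableOn (fun x => w x * pderiv' k φ x) Ω volume :=
        Integrable.mul_bdd hw hc.aestronglyMeasurable (.of_forall hc')
      refine tendsto_integral_of_dominated_convergence (fun x => ‖w x * pderiv' k φ x‖)
        (fun n => ?_) hi.norm (fun n => .of_forall fun x => ?_)
        (.of_forall fun x => (hlim x).mul_const _)
      · exact ((hχd n).continuous.comp π.continuous).aestronglyMeasurable.mul
          hi.aestronglyMeasurable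
      · rw [norm_mul]
        exact mul_le_of_le_one_left (norm_nonneg _) (hχb n _)
    have h3 : ∀ n, ∫ x, χ n (π x) * (φ x * g x) ∂ρ =
        - ∫ x in Ω, χ n (π x) * (w x * pderiv' k φ x) := by
      intro n
      have hs : ContDiff ℝ (⊤ : ℕ∞) (fun x => χ n (π x)) := (hχd n).comp π.contDiff
      have h := hwg (fun x => χ n (π x) * φ x) (hs.mul hφ) hφc.mul_left
        (tsupport_mul_subset_right.trans hφΩ)
      simp only [pderiv'_mul k hs hφ, hχπ, mul_zero, add_zero] at h
      simp only [← mul_assoc]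
      rw [← neg_eq_iff_eq_neg, ← h]
      congr 1
      ext x
      ring
    have h4 : ∫ x in Ω, (π ⁻¹' C).indicator (fun _ => (1 : ℝ)) x * (w x * pderiv' k φ x) = 0 := by
      refine integral_eq_zero_of_ae ?_
      filter_upwards [ae_restrict_of_ae (measure_eq_zero_iff_ae_notMem.1 hKπ)] with x hx
      simp [Set.indicator_of_notMem hx]
    simp only [h3] at h1
    have h5 := tendsto_nhds_unique h1 h2.neg
    rw [h4, neg_zero] at h5
    rw [← h5]
    congr 1
    ext x
    by_cases hx : x ∈ π ⁻¹' C
    · simp [Set.indicator_of_mem hx]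
    · simp [Set.indicator_of_notMem hx]
  filter_upwards [hΩ.ae_eq_zero_of_integral_contDiff_smul_eq_zero
    ((hg.indicator hL).locallyIntegrable.locallyIntegrableOn _) hzero] with x hx hxK
  have := hx (hKΩ hxK)
  rwa [Set.indicator_of_mem (show x ∈ π ⁻¹' C from ⟨x, hxK, rfl⟩)] at this

/-- Almost all slices of a null set are null. -/
lemma ae_volume_slice_eq_zero (ι : ℝ × ℝ →L[ℝ] EuclideanSpace ℝ (Fin d))
    {K : Set (EuclideanSpace ℝ (Fin d))} (hK : MeasurableSet K) (hK0 : volume K = 0) :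
    Measurable (fun x => volume {p : ℝ × ℝ | x + ι p ∈ K}) ∧
      ∀ᵐ x, volume {p : ℝ × ℝ | x + ι p ∈ K} = 0 := by
  have hm : MeasurableSet {z : EuclideanSpace ℝ (Fin d) × (ℝ × ℝ) | z.1 + ι z.2 ∈ K} :=
    hK.preimage (by fun_prop)
  refine ⟨measurable_measure_prodMk_left hm, ?_⟩
  refine (Measure.measure_prod_null (μ := volume) (ν := volume) hm).1 ?_
  rw [Measure.prod_apply_symm hm]
  refine (lintegral_congr fun p => ?_).trans lintegral_zero
  exact (measure_preimage_add_right volume (ι p) K).trans hK0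

/-- The integral identities defining the derivative of a function of bounded variation say that its
columns are curl-free. -/
lemma integral_pderiv'_mul_comm {Ω : Set (EuclideanSpace ℝ (Fin d))}
    {ρ : Measure (EuclideanSpace ℝ (Fin d))} {w F₁ F₂ : EuclideanSpace ℝ (Fin d) → ℝ}
    (hF₁ : ∀ φ : EuclideanSpace ℝ (Fin d) → ℝ, ContDiff ℝ (⊤ : ℕ∞) φ → HasCompactSupport φ →
      tsupport φ ⊆ Ω → ∫ x in Ω, w x * pderiv' i φ x ∂volume = - ∫ x, φ x * F₁ x ∂ρ)
    (hF₂ : ∀ φ : EuclideanSpace ℝ (Fin d) → ℝ, ContDiff ℝ (⊤ : ℕ∞) φ → HasCompactSupport φ →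
      tsupport φ ⊆ Ω → ∫ x in Ω, w x * pderiv' j φ x ∂volume = - ∫ x, φ x * F₂ x ∂ρ)
    (ψ : EuclideanSpace ℝ (Fin d) → ℝ) (hψ : ContDiff ℝ (⊤ : ℕ∞) ψ) (hψc : HasCompactSupport ψ)
    (hψΩ : tsupport ψ ⊆ Ω) :
    ∫ x, pderiv' j ψ x * F₁ x ∂ρ = ∫ x, pderiv' i ψ x * F₂ x ∂ρ := by
  have h₁ := hF₁ _ (contDiff_pderiv' j hψ) (hasCompactSupport_pderiv' j hψc)
    ((tsupport_pderiv'_subset j ψ).trans hψΩ)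
  have h₂ := hF₂ _ (contDiff_pderiv' i hψ) (hasCompactSupport_pderiv' i hψc)
    ((tsupport_pderiv'_subset i ψ).trans hψΩ)
  rw [pderiv'_comm i j hψ] at h₁
  exact neg_injective (h₁.symm.trans h₂)

/-- Two planar gradient fields cannot be transversal on a Lebesgue null set of positive
`ρ`-measure. -/
lemma measure_eq_zero_of_transversal (hij : i ≠ j) {Ω : Set (EuclideanSpace ℝ (Fin d))}
    (hΩ : IsOpen Ω) (ρ : Measure (EuclideanSpace ℝ (Fin d))) [IsFiniteMeasure ρ]
    {v w F₁ F₂ H₁ H₂ : EuclideanSpace ℝ (Fin d) → ℝ} {C : ℝ} (hC : 1 ≤ C)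
    (hv : IntegrableOn v Ω volume)
    (hF₁m : AEStronglyMeasurable F₁ ρ) (hF₂m : AEStronglyMeasurable F₂ ρ)
    (hH₁m : AEStronglyMeasurable H₁ ρ) (hH₂m : AEStronglyMeasurable H₂ ρ)
    (hF₁C : ∀ᵐ x ∂ρ, |F₁ x| ≤ C) (hF₂C : ∀ᵐ x ∂ρ, |F₂ x| ≤ C)
    (hH₁C : ∀ᵐ x ∂ρ, |H₁ x| ≤ C) (hH₂C : ∀ᵐ x ∂ρ, |H₂ x| ≤ C)
    (hF₁ : ∀ φ : EuclideanSpace ℝ (Fin d) → ℝ, ContDiff ℝ (⊤ : ℕ∞) φ → HasCompactSupport φ →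
      tsupport φ ⊆ Ω → ∫ x in Ω, v x * pderiv' i φ x ∂volume = - ∫ x, φ x * F₁ x ∂ρ)
    (hF₂ : ∀ φ : EuclideanSpace ℝ (Fin d) → ℝ, ContDiff ℝ (⊤ : ℕ∞) φ → HasCompactSupport φ →
      tsupport φ ⊆ Ω → ∫ x in Ω, v x * pderiv' j φ x ∂volume = - ∫ x, φ x * F₂ x ∂ρ)
    (hH₁ : ∀ φ : EuclideanSpace ℝ (Fin d) → ℝ, ContDiff ℝ (⊤ : ℕ∞) φ → HasCompactSupport φ →
      tsupport φ ⊆ Ω → ∫ x in Ω, w x * pderiv' i φ x ∂volume = - ∫ x, φ x * H₁ x ∂ρ)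
    (hH₂ : ∀ φ : EuclideanSpace ℝ (Fin d) → ℝ, ContDiff ℝ (⊤ : ℕ∞) φ → HasCompactSupport φ →
      tsupport φ ⊆ Ω → ∫ x in Ω, w x * pderiv' j φ x ∂volume = - ∫ x, φ x * H₂ x ∂ρ)
    {T : Set (EuclideanSpace ℝ (Fin d))} (hT : MeasurableSet T) (hTΩ : T ⊆ Ω)
    (hT0 : volume T = 0)
    (hTF : ∀ x ∈ T, 1 / 2 ≤ F₁ x ∧ F₂ x ≤ -(1 / 2) ∧ 1 / 2 ≤ H₁ x ∧ 1 / 2 ≤ H₂ x) :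
    ρ T = 0 := by
  have hreg : ∀ S : Set (EuclideanSpace ℝ (Fin d)), MeasurableSet S →
      (∀ K ⊆ S, IsCompact K → ρ K = 0) → ρ S = 0 := by
    intro S hS h
    rw [hS.measure_eq_iSup_isCompact]
    simpa using h
  refine hreg T hT fun K hKT hK => ?_
  obtain ⟨hm, hae⟩ := ae_volume_slice_eq_zero (planeEmb i j) hK.measurableSet
    (measure_mono_null hKT hT0)
  set S := {x | volume {p : ℝ × ℝ | x + planeEmb i j p ∈ K} = 0} with hSdef
  have hS : MeasurableSet S := hm (measurableSet_singleton 0)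
  have hSinv : ∀ x p, x + planeEmb i j p ∈ S → x ∈ S := by
    intro x p hx
    simp only [hSdef, Set.mem_ofPred_eq] at hx ⊢
    rw [← measure_preimage_add_right volume p, ← hx]
    congr 1
    ext q
    simp only [Set.mem_preimage, Set.mem_ofPred_eq, map_add]
    rw [add_assoc, add_comm (planeEmb i j p)]
  have hS1 : ρ (K ∩ S) = 0 := by
    refine hreg _ (hK.measurableSet.inter hS) fun L hLS hL => ?_
    refine measure_eq_zero_of_curl_free hij hΩ ρ hC hF₁m hF₂m hH₁m hH₂m hF₁C hF₂C hH₁C hH₂C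
      (integral_pderiv'_mul_comm hF₁ hF₂) (integral_pderiv'_mul_comm hH₁ hH₂) hL
      (fun x hx => hTΩ (hKT (hLS hx).1))
      (fun x hx => measure_mono_null (fun p hp => (hLS hp).1) (hLS hx).2)
      fun x hx => hTF x (hKT (hLS hx).1)
  have hS2 : ρ (K \ S) = 0 := by
    refine hreg _ (hK.measurableSet.diff hS) fun L hLS hL => ?_
    have hLΩ : L ⊆ Ω := fun x hx => hTΩ (hKT (hLS hx).1)
    have h := ae_eq_zero_of_volume_preimage_image_eq_zero hΩ ρ hv (.of_bound hF₁m C hF₁C) hF₁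
      (planeProj i j) (by rw [← planeEmb_one_zero (i := i) (j := j), planeProj_planeEmb hij])
      hL hLΩ (measure_mono_null (t := Sᶜ) ?_ hae)
    · refine measure_eq_zero_iff_ae_notMem.2 (h.mono fun x h0 hx => ?_)
      have := (hTF x (hKT (hLS hx).1)).1
      rw [h0 hx] at this
      norm_num at this
    · rintro x ⟨y, hy, hxy⟩ hxS
      refine (hLS hy).2 ?_
      refine hSinv y (planeCoord i j x - planeCoord i j y) ?_
      have : y + planeEmb i j (planeCoord i j x - planeCoord i j y) = x := by
        conv_rhs => rw [← planeProj_add (i := i) (j := j) x, ← hxy]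
        conv_lhs => enter [1]; rw [← planeProj_add (i := i) (j := j) y]
        rw [map_sub]
        abel
      rwa [this]
  rw [← measure_inter_add_sdiff K hS, hS1, hS2, add_zero]

end slices

/-- An invertible `2 × 2` matrix can be brought into a given open region by rational row
operations. -/
lemma exists_rat_combination {a b c e : ℝ} (h : a * e - b * c ≠ 0) {p q : ℝ} {O : Set (ℝ × ℝ)}
    (hO : IsOpen O) (hpq : (p, q) ∈ O) :
    ∃ r : ℚ × ℚ, ((r.1 : ℝ) * a + r.2 * c, (r.1 : ℝ) * b + r.2 * e) ∈ O := by
  have hd : DenseRange (Prod.map ((↑) : ℚ → ℝ) ((↑) : ℚ → ℝ)) :=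
    Rat.denseRange_cast.prodMap Rat.denseRange_cast
  have hc : Continuous fun s : ℝ × ℝ => (s.1 * a + s.2 * c, s.1 * b + s.2 * e) := by fun_prop
  obtain ⟨r, hr⟩ := hd.exists_mem_open (hO.preimage hc)
    ⟨((p * e - q * c) / (a * e - b * c), (q * a - p * b) / (a * e - b * c)), by
      have h₁ : (p * e - q * c) / (a * e - b * c) * a + (q * a - p * b) / (a * e - b * c) * c = p := by
        rw [div_mul_eq_mul_div, div_mul_eq_mul_div, ← add_div, div_eq_iff h]; ring
      have h₂ : (p * e - q * c) / (a * e - b * c) * b + (q * a - p * b) / (a * e - b * c) * e = q := by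
        rw [div_mul_eq_mul_div, div_mul_eq_mul_div, ← add_div, div_eq_iff h]; ring
      simpa only [Set.mem_preimage, h₁, h₂] using hpq⟩
  exact ⟨r, hr⟩

/-- A nonzero matrix all of whose `2 × 2` minors vanish is a product of two vectors. -/
lemma exists_eq_mul_of_minors_eq_zero {m n : Type*} {M : Matrix m n ℝ} (hM : M ≠ 0)
    (h : ∀ k₁ k₂ i j, M k₁ i * M k₂ j - M k₁ j * M k₂ i = 0) :
    ∃ (a : m → ℝ) (b : n → ℝ), a ≠ 0 ∧ b ≠ 0 ∧ ∀ k j, M k j = a k * b j := by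
  obtain ⟨k₀, j₀, h₀⟩ : ∃ k j, M k j ≠ 0 := by
    by_contra! h'
    exact hM (Matrix.ext h')
  refine ⟨fun k => M k j₀, fun j => M k₀ j / M k₀ j₀, fun h' => h₀ (congrFun h' k₀), fun h' => ?_,
    fun k j => ?_⟩
  · have := congrFun h' j₀
    simp [h₀] at this
  · have := h k k₀ j j₀
    field_simp
    linarith

/-- **Alberti's rank-one theorem.**
Let `u ∈ BV(Ω; ℝ^ℓ)`: `u ∈ L¹(Ω; ℝ^ℓ)` and its distributional derivative is the finite
`ℝ^{ℓ×d}`-valued Radon measure `Du = f·ρ`, represented by its total variation measure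
`ρ = |Du|` (a finite positive measure concentrated on `Ω`) and its polar
`f = d(Du)/d|Du|`, of (Frobenius) norm one `ρ`-a.e.  Then at `|D^s u|`-a.e. point the
polar is a rank-one matrix `a ⊗ b`. -/
theorem statement2 {d l : ℕ}
    (Ω : Set (EuclideanSpace ℝ (Fin d))) (hΩ : IsOpen Ω)
    (u : EuclideanSpace ℝ (Fin d) → EuclideanSpace ℝ (Fin l))
    (hu : IntegrableOn u Ω volume)
    (ρ : Measure (EuclideanSpace ℝ (Fin d))) [IsFiniteMeasure ρ]
    (hρΩ : ρ Ωᶜ = 0)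
    (f : EuclideanSpace ℝ (Fin d) → Matrix (Fin l) (Fin d) ℝ)
    (hf : AEStronglyMeasurable f ρ)
    (hpolar : ∀ᵐ x ∂ρ, ∑ k, ∑ j, (f x k j) ^ 2 = 1)
    (hDu : ∀ φ : EuclideanSpace ℝ (Fin d) → ℝ,
      ContDiff ℝ (⊤ : ℕ∞) φ → HasCompactSupport φ → tsupport φ ⊆ Ω →
      ∀ (k : Fin l) (j : Fin d),
        ∫ x in Ω, u x k * pderiv' j φ x ∂volume = - ∫ x, φ x * f x k j ∂ρ) :
    ∀ᵐ x ∂(ρ.singularPart volume),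
      ∃ (a : Fin l → ℝ) (b : Fin d → ℝ), a ≠ 0 ∧ b ≠ 0 ∧
        ∀ (k : Fin l) (j : Fin d), f x k j = a k * b j := by
  set g := hf.mk f with hg
  have hgf : f =ᵐ[ρ] g := hf.ae_eq_mk
  have hgm : ∀ k j, StronglyMeasurable fun x => g x k j := fun k j =>
    (show Continuous fun M : Matrix (Fin l) (Fin d) ℝ => M k j by
      fun_prop).comp_stronglyMeasurable hf.stronglyMeasurable_mk
  have hgb : ∀ᵐ x ∂ρ, ∀ k j, |g x k j| ≤ 1 := by
    filter_upwards [hpolar, hgf] with x hx hxg k j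
    rw [hxg] at hx
    rw [← sq_le_one_iff_abs_le_one, ← hx]
    exact (Finset.single_le_sum (f := fun j => g x k j ^ 2) (fun _ _ => sq_nonneg _)
      (Finset.mem_univ j)).trans (Finset.single_le_sum (f := fun k => ∑ j, g x k j ^ 2)
      (fun _ _ => Finset.sum_nonneg fun _ _ => sq_nonneg _) (Finset.mem_univ k))
  have hui : ∀ k, IntegrableOn (fun x => u x k) Ω volume := fun k =>
    (EuclideanSpace.proj (𝕜 := ℝ) k).integrable_comp hu
  have hgi : ∀ k j, Integrable (fun x => g x k j) ρ := fun k j =>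
    .of_bound (hgm k j).aestronglyMeasurable 1 (hgb.mono fun x hx => hx k j)
  have hDg : ∀ (r₁ r₂ : ℝ) (k₁ k₂ : Fin l) (j : Fin d) (φ : EuclideanSpace ℝ (Fin d) → ℝ),
      ContDiff ℝ (⊤ : ℕ∞) φ → HasCompactSupport φ → tsupport φ ⊆ Ω →
      ∫ x in Ω, (r₁ * u x k₁ + r₂ * u x k₂) * pderiv' j φ x ∂volume =
        - ∫ x, φ x * (r₁ * g x k₁ j + r₂ * g x k₂ j) ∂ρ := by
    intro r₁ r₂ k₁ k₂ j φ hφ hφc hφΩ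
    have hc := (contDiff_pderiv' j hφ).continuous
    obtain ⟨c, hc'⟩ := (hasCompactSupport_pderiv' j hφc).exists_bound_of_continuous hc
    have h1 : ∀ k, IntegrableOn (fun x => u x k * pderiv' j φ x) Ω volume := fun k =>
      Integrable.mul_bdd (hui k) hc.aestronglyMeasurable (.of_forall hc')
    have h2 : ∀ k, Integrable (fun x => φ x * g x k j) ρ := fun k =>
      integrable_mul_of_hasCompactSupport (hgi k j) hφ.continuous hφc
    have h3 : ∀ k, ∫ x in Ω, u x k * pderiv' j φ x ∂volume = - ∫ x, φ x * g x k j ∂ρ := by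
      intro k
      rw [hDu φ hφ hφc hφΩ k j]
      congr 1
      exact integral_congr_ae (hgf.mono fun x hx => by simp only [hx])
    simp only [add_mul, mul_add, mul_assoc, mul_left_comm (φ _)]
    rw [integral_add ((h1 k₁).const_mul _) ((h1 k₂).const_mul _),
      integral_add ((h2 k₁).const_mul _) ((h2 k₂).const_mul _)]
    simp only [integral_const_mul, h3]
    ring
  obtain ⟨S, hS, hρS, hS0⟩ := Measure.mutuallySingular_singularPart ρ volume
  have hnull : ∀ (k₁ k₂ : Fin l) (i j : Fin d),
      ρ {x ∈ Sᶜ ∩ Ω | g x k₁ i * g x k₂ j - g x k₁ j * g x k₂ i ≠ 0} = 0 := by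
    intro k₁ k₂ i j
    by_cases hij : i = j
    · simp [hij]
    let T : (ℚ × ℚ) × (ℚ × ℚ) → Set (EuclideanSpace ℝ (Fin d)) := fun r =>
      {x ∈ Sᶜ ∩ Ω | (1 / 2 ≤ r.1.1 * g x k₁ i + r.1.2 * g x k₂ i ∧
        r.1.1 * g x k₁ j + r.1.2 * g x k₂ j ≤ -(1 / 2)) ∧
        1 / 2 ≤ r.2.1 * g x k₁ i + r.2.2 * g x k₂ i ∧
        1 / 2 ≤ r.2.1 * g x k₁ j + r.2.2 * g x k₂ j}
    refine measure_mono_null (t := ⋃ r, T r) ?_ (measure_iUnion_null fun r => ?_)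
    · rintro x ⟨hx, hxm⟩
      obtain ⟨r, hr1, hr2⟩ := exists_rat_combination hxm (p := 1) (q := -1)
        (isOpen_Ioi (a := (1 / 2 : ℝ)) |>.prod (isOpen_Iio (a := (-(1 / 2) : ℝ))))
        ⟨by norm_num, by norm_num⟩
      obtain ⟨s, hs1, hs2⟩ := exists_rat_combination hxm (p := 1) (q := 1)
        (isOpen_Ioi (a := (1 / 2 : ℝ)) |>.prod (isOpen_Ioi (a := (1 / 2 : ℝ))))
        ⟨by norm_num, by norm_num⟩
      exact Set.mem_iUnion.2 ⟨(r, s), hx, ⟨hr1.le, hr2.le⟩, hs1.le, hs2.le⟩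
    · have hm : ∀ (a b : ℚ) (j : Fin d),
          StronglyMeasurable fun x => a * g x k₁ j + b * g x k₂ j := fun a b j =>
        ((hgm k₁ j).const_mul _).add ((hgm k₂ j).const_mul _)
      set C : ℝ := 1 + (|(r.1.1 : ℝ)| + |(r.1.2 : ℝ)| + (|(r.2.1 : ℝ)| + |(r.2.2 : ℝ)|)) with hC
      have hb : ∀ (a b : ℚ) (j : Fin d), |(a : ℝ)| + |(b : ℝ)| ≤ C →
          ∀ᵐ x ∂ρ, |a * g x k₁ j + b * g x k₂ j| ≤ C := by
        intro a b j hab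
        filter_upwards [hgb] with x hx
        calc |a * g x k₁ j + b * g x k₂ j| ≤ |a * g x k₁ j| + |b * g x k₂ j| := abs_add_le _ _
          _ ≤ |(a : ℝ)| * 1 + |(b : ℝ)| * 1 := by
              rw [abs_mul, abs_mul]
              gcongr <;> exact hx _ _
          _ ≤ C := by linarith
      have hC1 : |(r.1.1 : ℝ)| + |(r.1.2 : ℝ)| ≤ C := by
        have := abs_nonneg (r.2.1 : ℝ); have := abs_nonneg (r.2.2 : ℝ); linarith
      have hC2 : |(r.2.1 : ℝ)| + |(r.2.2 : ℝ)| ≤ C := by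
        have := abs_nonneg (r.1.1 : ℝ); have := abs_nonneg (r.1.2 : ℝ); linarith
      refine measure_eq_zero_of_transversal hij hΩ ρ
        (v := fun x => r.1.1 * u x k₁ + r.1.2 * u x k₂)
        (w := fun x => r.2.1 * u x k₁ + r.2.2 * u x k₂)
        (F₁ := fun x => r.1.1 * g x k₁ i + r.1.2 * g x k₂ i)
        (F₂ := fun x => r.1.1 * g x k₁ j + r.1.2 * g x k₂ j)
        (H₁ := fun x => r.2.1 * g x k₁ i + r.2.2 * g x k₂ i)
        (H₂ := fun x => r.2.1 * g x k₁ j + r.2.2 * g x k₂ j) (C := C)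
        (by rw [hC]; exact le_add_of_nonneg_right (by positivity))
        (((hui k₁).const_mul _).add ((hui k₂).const_mul _))
        (hm _ _ _).aestronglyMeasurable (hm _ _ _).aestronglyMeasurable
        (hm _ _ _).aestronglyMeasurable (hm _ _ _).aestronglyMeasurable
        (hb _ _ _ hC1) (hb _ _ _ hC1) (hb _ _ _ hC2) (hb _ _ _ hC2)
        (hDg _ _ _ _ _) (hDg _ _ _ _ _) (hDg _ _ _ _ _) (hDg _ _ _ _ _) ?_
        (fun x hx => hx.1.2) (measure_mono_null (fun x hx => hx.1.1) hS0)
        fun x hx => ⟨hx.2.1.1, hx.2.1.2, hx.2.2⟩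
      refine (hS.compl.inter hΩ.measurableSet).inter (.inter (.inter ?_ ?_) (.inter ?_ ?_))
      · exact measurableSet_le measurable_const (hm _ _ _).measurable
      · exact measurableSet_le (hm _ _ _).measurable measurable_const
      · exact measurableSet_le measurable_const (hm _ _ _).measurable
      · exact measurableSet_le measurable_const (hm _ _ _).measurable
  have hle : ρ.singularPart volume ≤ ρ := Measure.singularPart_le _ _
  have hae : ∀ᵐ x ∂ρ, ∀ k₁ k₂ i j,
      x ∈ Sᶜ ∩ Ω → g x k₁ i * g x k₂ j - g x k₁ j * g x k₂ i = 0 := by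
    simp only [ae_all_iff]
    intro k₁ k₂ i j
    filter_upwards [measure_eq_zero_iff_ae_notMem.1 (hnull k₁ k₂ i j)] with x hx hxS
    by_contra h
    exact hx ⟨hxS, h⟩
  filter_upwards [ae_mono hle hae, ae_mono hle hgf, ae_mono hle hpolar,
    ae_mono hle (measure_eq_zero_iff_ae_notMem.1 hρΩ), measure_eq_zero_iff_ae_notMem.1 hρS]
    with x hx hxg hxp hxΩ hxS
  refine exists_eq_mul_of_minors_eq_zero (fun h => ?_) fun k₁ k₂ i j => ?_
  · simp [h] at hxp
  · rw [hxg]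
    exact hx k₁ k₂ i j ⟨hxS, not_not.1 hxΩ⟩
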